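/- Suppose a linear map Φ on (dA·dB)×(dA·dB) complex matrices has the discord-annihilating normal form: there exist a CPTP map E on (dA·dB)×(dA·dB) matrices; a finite index set partitioned into disjoint subsets I_BOTH, I_FIXED, I_POINT; an orthonormal family {|ψ_i⟩ : i ∈ I_BOTH ∪ I_FIXED} in ℂ^{dA}; orthogonal projections {P_i : i ∈ I_POINT} on ℂ^{dA} of rank at least 2 with mutually orthogonal ranges, each orthogonal to every |ψ_i⟩, such that Σ_{i∈I_BOTH∪I_FIXED} |ψ_i⟩⟨ψ_i| + Σ_{i∈I_POINT} P_i = I_{dA}; and states {R_i : i ∈ I_BOTH ∪ I_POINT} on ℂ^{dB}; such that for all matrices ρ, Φ(ρ) = Σ_{i∈I_BOTH} tr_B[(|ψ_i⟩⟨ψ_i| ⊗ I)E(ρ)(|ψ_i⟩⟨ψ_i| ⊗ I)] ⊗ R_i + Σ_{i∈I_FIXED} (|ψ_i⟩⟨ψ_i| ⊗ I)E(ρ)(|ψ_i⟩⟨ψ_i| ⊗ I) + Σ_{i∈I_POINT} tr_B[(P_i ⊗ I)E(ρ)(P_i ⊗ I)] ⊗ R_i, where tr_B denotes the partial trace over ℂ^{dB}.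 Then Φ is a CPTP map and Φ(ρ) is classical-quantum with respect to subsystem A for every state ρ on ℂ^{dA} ⊗ ℂ^{dB}; i.e., Φ is discord-annihilating. (Converse direction of Theorem 2.) -/

import Mathlib

open Matrix
open scoped Kronecker ComplexOrder

noncomputable section

/-- A state: positive semidefinite matrix with unit trace. -/
def IsState {ι : Type} [Fintype ι] (ρ : Matrix ι ι ℂ) : Prop :=
  ρ.PosSemidef ∧ ρ.trace = 1

/-- The rank-one matrix `|ψ⟩⟨ψ| = ψ ψ†`. -/
def outer {d : ℕ} (ψ : Fin d → ℂ) : Matrix (Fin d) (Fin d) ℂ :=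
  Matrix.of fun i j => ψ i * star (ψ j)

/-- A bipartite state (on `ℂ^{dA} ⊗ ℂ^{dB}`, Kronecker-product convention) is
classical-quantum with respect to subsystem `A` if it is a convex combination
`∑ k, p k • |ψ k⟩⟨ψ k| ⊗ σB k` with `{ψ k}` orthonormal in `ℂ^{dA}` and `σB k` states. -/
def IsCQ {dA dB : ℕ} (ρ : Matrix (Fin dA × Fin dB) (Fin dA × Fin dB) ℂ) : Prop :=
  ∃ (n : ℕ) (ψ : Fin n → Fin dA → ℂ) (p : Fin n → ℝ)
    (σB : Fin n → Matrix (Fin dB) (Fin dB) ℂ),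
      (∀ k l, star (ψ k) ⬝ᵥ ψ l = if k = l then 1 else 0) ∧
      (∀ k, 0 ≤ p k) ∧ (∑ k, p k = 1) ∧ (∀ k, IsState (σB k)) ∧
      ρ = ∑ k, (p k : ℂ) • (outer (ψ k) ⊗ₖ σB k)

/-- The `(a,b)` block (a matrix on the second factor) of a matrix on `Fin m × ι`. -/
def blockA {m : ℕ} {ι : Type} (a b : Fin m) :
    Matrix (Fin m × ι) (Fin m × ι) ℂ →ₗ[ℂ] Matrix ι ι ℂ where
  toFun M := Matrix.of fun i j => M (a, i) (b, j)
  map_add' _ _ := rfl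
  map_smul' _ _ := rfl

/-- The `(i,j)` slice (a matrix on the first factor) of a matrix on `Fin m × Fin d`. -/
def blockB {m d : ℕ} (i j : Fin d) :
    Matrix (Fin m × Fin d) (Fin m × Fin d) ℂ →ₗ[ℂ] Matrix (Fin m) (Fin m) ℂ where
  toFun M := Matrix.of fun a b => M (a, i) (b, j)
  map_add' _ _ := rfl
  map_smul' _ _ := rfl

/-- `id_m ⊗ Φ`: the extension of `Φ` (acting on the second factor) by the identity
on the first factor.  On Kronecker products, `(id_m ⊗ Φ)(Y ⊗ₖ X) = Y ⊗ₖ Φ X`. -/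
def idTensor {ι : Type} (m : ℕ) (Φ : Matrix ι ι ℂ →ₗ[ℂ] Matrix ι ι ℂ) :
    Matrix (Fin m × ι) (Fin m × ι) ℂ →ₗ[ℂ] Matrix (Fin m × ι) (Fin m × ι) ℂ where
  toFun M := Matrix.of fun p q => Φ (blockA p.1 q.1 M) p.2 q.2
  map_add' M N := by
    ext ⟨a, i⟩ ⟨b, j⟩
    simp [Matrix.add_apply]
  map_smul' c M := by
    ext ⟨a, i⟩ ⟨b, j⟩
    simp [Matrix.smul_apply]

/-- `Φ ⊗ id_m`: the extension of `Φ` (acting on the first factor) by the identity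
on the second factor.  On Kronecker products, `(Φ ⊗ id_m)(X ⊗ₖ Y) = Φ X ⊗ₖ Y`. -/
def tensorId {d : ℕ} (Φ : Matrix (Fin d) (Fin d) ℂ →ₗ[ℂ] Matrix (Fin d) (Fin d) ℂ)
    (m : ℕ) :
    Matrix (Fin d × Fin m) (Fin d × Fin m) ℂ →ₗ[ℂ]
      Matrix (Fin d × Fin m) (Fin d × Fin m) ℂ where
  toFun M := Matrix.of fun p q => Φ (blockB p.2 q.2 M) p.1 q.1
  map_add' M N := by
    ext ⟨a, i⟩ ⟨b, j⟩
    simp [Matrix.add_apply]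
  map_smul' c M := by
    ext ⟨a, i⟩ ⟨b, j⟩
    simp [Matrix.smul_apply]

/-- CPTP: trace preserving and completely positive (every extension `id_k ⊗ Φ`
maps positive semidefinite matrices to positive semidefinite matrices). -/
def IsCPTP {ι : Type} [Fintype ι] (Φ : Matrix ι ι ℂ →ₗ[ℂ] Matrix ι ι ℂ) : Prop :=
  (∀ X, (Φ X).trace = X.trace) ∧
  ∀ k : ℕ, ∀ M : Matrix (Fin k × ι) (Fin k × ι) ℂ,
    M.PosSemidef → (idTensor k Φ M).PosSemidef

/-- Partial trace over the second (B) factor: `tr_B(X ⊗ₖ Y) = tr(Y) • X`. -/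
def ptraceB {dA dB : ℕ} (M : Matrix (Fin dA × Fin dB) (Fin dA × Fin dB) ℂ) :
    Matrix (Fin dA) (Fin dA) ℂ :=
  Matrix.of fun a b => ∑ i, M (a, i) (b, i)

/-- The point channel with fixed state `σ`: `X ↦ tr(X) • σ`. -/
def pointChannel {d : ℕ} (σ : Matrix (Fin d) (Fin d) ℂ) :
    Matrix (Fin d) (Fin d) ℂ →ₗ[ℂ] Matrix (Fin d) (Fin d) ℂ where
  toFun X := X.trace • σ
  map_add' X Y := by simp [Matrix.trace_add, add_smul]
  map_smul' c X := by simp [Matrix.trace_smul, smul_smul]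

/-- A quantum-classical channel: `Φ(X) = ∑ k, tr(F k * X) • |ψ k⟩⟨ψ k|` for an
orthonormal family `{ψ k}` and a POVM `{F k}`. -/
def IsQCChannel {d : ℕ} (Φ : Matrix (Fin d) (Fin d) ℂ →ₗ[ℂ] Matrix (Fin d) (Fin d) ℂ) :
    Prop :=
  ∃ (n : ℕ) (ψ : Fin n → Fin d → ℂ) (F : Fin n → Matrix (Fin d) (Fin d) ℂ),
    (∀ k l, star (ψ k) ⬝ᵥ ψ l = if k = l then 1 else 0) ∧
    (∀ k, (F k).PosSemidef) ∧ (∑ k, F k = 1) ∧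
    (∀ X, Φ X = ∑ k, (F k * X).trace • outer (ψ k))

/-- The discord-annihilating normal form of Theorem 2: an arbitrary CPTP map `E`
followed by orthogonal subspace projections on `A` (rank-one projectors
`|ψ i⟩⟨ψ i|` for `i ∈ IB ∪ IF`, higher-rank projectors `P i` for `i ∈ IP`)
combined with conditional point channels (`R i`) or the identity on `B`. -/
def HasDANormalForm {dA dB : ℕ}
    (Φ : Matrix (Fin dA × Fin dB) (Fin dA × Fin dB) ℂ →ₗ[ℂ]
      Matrix (Fin dA × Fin dB) (Fin dA × Fin dB) ℂ) : Prop :=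
  ∃ (E : Matrix (Fin dA × Fin dB) (Fin dA × Fin dB) ℂ →ₗ[ℂ]
        Matrix (Fin dA × Fin dB) (Fin dA × Fin dB) ℂ)
    (n : ℕ) (IB IF IP : Finset (Fin n))
    (ψ : Fin n → Fin dA → ℂ)
    (P : Fin n → Matrix (Fin dA) (Fin dA) ℂ)
    (R : Fin n → Matrix (Fin dB) (Fin dB) ℂ),
      IsCPTP E ∧
      -- the three index sets are disjoint and exhaust the index set
      Disjoint IB IF ∧ Disjoint IB IP ∧ Disjoint IF IP ∧
      IB ∪ IF ∪ IP = Finset.univ ∧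
      -- `{ψ i : i ∈ IB ∪ IF}` is an orthonormal family in ℂ^{dA}
      (∀ i ∈ IB ∪ IF, ∀ j ∈ IB ∪ IF,
        star (ψ i) ⬝ᵥ ψ j = if i = j then 1 else 0) ∧
      -- the `P i`, `i ∈ IP`, are orthogonal projections of rank at least 2
      (∀ i ∈ IP, (P i).IsHermitian ∧ P i * P i = P i ∧ 2 ≤ (P i).rank) ∧
      -- with mutually orthogonal ranges,
      (∀ i ∈ IP, ∀ j ∈ IP, i ≠ j → P i * P j = 0) ∧
      -- each orthogonal to every `ψ j`,
      (∀ i ∈ IP, ∀ j ∈ IB ∪ IF, P i * outer (ψ j) = 0) ∧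
      -- and together they resolve the identity on `A`
      (∑ i ∈ IB ∪ IF, outer (ψ i)) + (∑ i ∈ IP, P i) = 1 ∧
      -- the `R i` are states on `B`
      (∀ i ∈ IB ∪ IP, IsState (R i)) ∧
      -- the normal form itself
      (∀ ρ, Φ ρ =
        (∑ i ∈ IB,
          ptraceB ((outer (ψ i) ⊗ₖ (1 : Matrix (Fin dB) (Fin dB) ℂ)) * E ρ *
            (outer (ψ i) ⊗ₖ 1)) ⊗ₖ R i) +
        (∑ i ∈ IF,
          (outer (ψ i) ⊗ₖ (1 : Matrix (Fin dB) (Fin dB) ℂ)) * E ρ *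
            (outer (ψ i) ⊗ₖ 1)) +
        (∑ i ∈ IP,
          ptraceB ((P i ⊗ₖ (1 : Matrix (Fin dB) (Fin dB) ℂ)) * E ρ *
            (P i ⊗ₖ 1)) ⊗ₖ R i))

section Auxiliary

variable {dA dB : ℕ}

theorem outer_isHermitian {d : ℕ} (ψ : Fin d → ℂ) : (outer ψ).IsHermitian := by
  ext i j
  simp [outer, mul_comm]

theorem outer_mulVec {d : ℕ} (ψ φ : Fin d → ℂ) :
    outer ψ *ᵥ φ = (star ψ ⬝ᵥ φ) • ψ := by
  ext i
  simp only [outer, mulVec, dotProduct, of_apply, Pi.smul_apply, smul_eq_mul, Finset.sum_mul,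
    Pi.star_apply]
  exact Finset.sum_congr rfl fun _ _ => by ring

theorem outer_mul_outer {d : ℕ} (ψ φ : Fin d → ℂ) :
    outer ψ * outer φ = (star ψ ⬝ᵥ φ) • Matrix.of fun i j => ψ i * star (φ j) := by
  ext i j
  simp only [outer, mul_apply, dotProduct, of_apply, Matrix.smul_apply, smul_eq_mul, Finset.sum_mul,
    Pi.star_apply]
  exact Finset.sum_congr rfl fun _ _ => by ring

theorem trace_outer {d : ℕ} (ψ : Fin d → ℂ) : (outer ψ).trace = star ψ ⬝ᵥ ψ := by
  simp [outer, trace, dotProduct, mul_comm]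

theorem ptraceB_eq_sum (M : Matrix (Fin dA × Fin dB) (Fin dA × Fin dB) ℂ) :
    ptraceB M = ∑ l, M.submatrix (fun a => (a, l)) (fun a => (a, l)) := by
  ext a b
  simp [ptraceB, Matrix.sum_apply]

theorem trace_ptraceB (M : Matrix (Fin dA × Fin dB) (Fin dA × Fin dB) ℂ) :
    (ptraceB M).trace = M.trace := by
  simp [ptraceB, trace, Fintype.sum_prod_type]

theorem blockA_apply {m : ℕ} {ι : Type} (a b : Fin m) (M : Matrix (Fin m × ι) (Fin m × ι) ℂ)
    (i j : ι) : blockA a b M i j = M (a, i) (b, j) := rfl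

theorem blockA_of {m : ℕ} {ι : Type} (a b : Fin m) (F : Fin m → Fin m → Matrix ι ι ℂ) :
    blockA a b (Matrix.of fun p q : Fin m × ι => F p.1 q.1 p.2 q.2) = F a b := rfl

theorem posSemidef_ptraceB {M : Matrix (Fin dA × Fin dB) (Fin dA × Fin dB) ℂ}
    (hM : M.PosSemidef) : (ptraceB M).PosSemidef := by
  rw [ptraceB_eq_sum]
  exact posSemidef_sum _ fun l _ => hM.submatrix _

theorem ptraceB_kronecker_one_mul (Q : Matrix (Fin dA) (Fin dA) ℂ)
    (M : Matrix (Fin dA × Fin dB) (Fin dA × Fin dB) ℂ) :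
    ptraceB ((Q ⊗ₖ (1 : Matrix (Fin dB) (Fin dB) ℂ)) * M) = Q * ptraceB M := by
  ext a b
  simp only [ptraceB, of_apply, mul_apply, kroneckerMap_apply, Fintype.sum_prod_type,
    Matrix.one_apply, mul_ite, mul_one, mul_zero, ite_mul, zero_mul, Finset.sum_ite_eq,
    Finset.mem_univ, if_true, Finset.mul_sum]
  exact Finset.sum_comm

theorem isHermitian_kronecker_one {Q : Matrix (Fin dA) (Fin dA) ℂ} (hQ : Q.IsHermitian) :
    (Q ⊗ₖ (1 : Matrix (Fin dB) (Fin dB) ℂ)).IsHermitian := by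
  rw [IsHermitian, conjTranspose_kronecker, hQ.eq, conjTranspose_one]

theorem posSemidef_kronecker_one_conj {Q : Matrix (Fin dA) (Fin dA) ℂ} (hQ : Q.IsHermitian)
    {M : Matrix (Fin dA × Fin dB) (Fin dA × Fin dB) ℂ} (hM : M.PosSemidef) :
    ((Q ⊗ₖ (1 : Matrix (Fin dB) (Fin dB) ℂ)) * M * (Q ⊗ₖ 1)).PosSemidef := by
  have h := hM.mul_mul_conjTranspose_same (Q ⊗ₖ (1 : Matrix (Fin dB) (Fin dB) ℂ))
  rwa [(isHermitian_kronecker_one hQ).eq] at h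

/-- `id_k ⊗ (X ↦ K X Kᴴ)` preserves positivity. -/
theorem posSemidef_blockwise_conj {ι : Type} [Fintype ι] {k : ℕ} (K : Matrix ι ι ℂ)
    {N : Matrix (Fin k × ι) (Fin k × ι) ℂ} (hN : N.PosSemidef) :
    (Matrix.of fun p q : Fin k × ι => (K * blockA p.1 q.1 N * Kᴴ) p.2 q.2).PosSemidef := by
  convert hN.mul_mul_conjTranspose_same ((1 : Matrix (Fin k) (Fin k) ℂ) ⊗ₖ K) using 1
  ext ⟨a, i⟩ ⟨b, j⟩
  simp [mul_apply, blockA_apply, Fintype.sum_prod_type, Matrix.one_apply, apply_ite]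

/-- `id_k ⊗ (X ↦ tr_B X ⊗ R)` preserves positivity. -/
theorem posSemidef_blockwise_ptraceB {k : ℕ} {R : Matrix (Fin dB) (Fin dB) ℂ}
    (hR : R.PosSemidef)
    {N : Matrix (Fin k × Fin dA × Fin dB) (Fin k × Fin dA × Fin dB) ℂ} (hN : N.PosSemidef) :
    (Matrix.of fun p q : Fin k × Fin dA × Fin dB =>
      (ptraceB (blockA p.1 q.1 N) ⊗ₖ R) p.2 q.2).PosSemidef := by
  have h : (∑ l, N.submatrix (fun x : Fin k × Fin dA => (x.1, x.2, l))
      (fun x => (x.1, x.2, l))).PosSemidef :=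
    posSemidef_sum _ fun l _ => hN.submatrix _
  have h' := (h.kronecker hR).submatrix
    (fun p : Fin k × Fin dA × Fin dB => ((p.1, p.2.1), p.2.2))
  refine (congrArg PosSemidef ?_).mpr h'
  ext ⟨a, i, l⟩ ⟨b, j, m⟩
  simp [ptraceB, blockA_apply, Matrix.sum_apply]

theorem blockA_idTensor {ι : Type} {k : ℕ} (E : Matrix ι ι ℂ →ₗ[ℂ] Matrix ι ι ℂ)
    (M : Matrix (Fin k × ι) (Fin k × ι) ℂ) (a b : Fin k) :
    blockA a b (idTensor k E M) = E (blockA a b M) := rfl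

theorem IsCPTP.isState_map {ι : Type} [Fintype ι] {E : Matrix ι ι ℂ →ₗ[ℂ] Matrix ι ι ℂ}
    (hE : IsCPTP E) {ρ : Matrix ι ι ℂ} (hρ : IsState ρ) : IsState (E ρ) :=
  ⟨(hE.2 1 _ (hρ.1.submatrix (Prod.snd : Fin 1 × ι → ι))).submatrix (fun i => ((0 : Fin 1), i)),
    (hE.1 ρ).trans hρ.2⟩

/-- `X` decomposes as `∑ k, |φ k⟩⟨φ k| ⊗ τ k` with positive `τ k`, where the `φ k` belonging to
nonzero `τ k` are orthonormal and fixed by `Q`. -/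
def IsCQOn (Q : Matrix (Fin dA) (Fin dA) ℂ)
    (X : Matrix (Fin dA × Fin dB) (Fin dA × Fin dB) ℂ) : Prop :=
  ∃ (m : ℕ) (φ : Fin m → Fin dA → ℂ) (τ : Fin m → Matrix (Fin dB) (Fin dB) ℂ),
    (∀ k, (τ k).PosSemidef) ∧ (∀ k, τ k ≠ 0 → Q *ᵥ φ k = φ k) ∧
    (∀ k l, star (φ k) ⬝ᵥ φ l = if k = l then 1 else 0) ∧
    X = ∑ k, outer (φ k) ⊗ₖ τ k

theorem isCQOn_kronecker {Q A : Matrix (Fin dA) (Fin dA) ℂ} {R : Matrix (Fin dB) (Fin dB) ℂ}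
    (hA : A.PosSemidef) (hQA : Q * A = A) (hR : R.PosSemidef) : IsCQOn Q (A ⊗ₖ R) := by
  have hH := hA.isHermitian
  have hv : ∀ k, A *ᵥ ⇑(hH.eigenvectorBasis k) =
      (hH.eigenvalues k : ℂ) • ⇑(hH.eigenvectorBasis k) := fun k => by
    simpa using hH.mulVec_eigenvectorBasis k
  refine ⟨dA, fun k => ⇑(hH.eigenvectorBasis k), fun k => (hH.eigenvalues k : ℂ) • R,
    fun k => ?_, fun k hk => ?_, fun k l => ?_, ?_⟩
  · exact hR.smul (by exact_mod_cast hA.eigenvalues_nonneg k)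
  · have h0 : (hH.eigenvalues k : ℂ) ≠ 0 := fun h => hk (by simp [h])
    have h1 := congrArg (Q *ᵥ ·) (hv k)
    simp only [mulVec_mulVec, hQA, mulVec_smul] at h1
    rw [hv k] at h1
    exact (smul_right_injective _ h0 h1).symm
  · have h := orthonormal_iff_ite.1 hH.eigenvectorBasis.orthonormal k l
    rw [EuclideanSpace.inner_eq_star_dotProduct, dotProduct_comm] at h
    exact h
  · have h : A = ∑ k, (hH.eigenvalues k : ℂ) • outer ⇑(hH.eigenvectorBasis k) := by
      ext i j
      conv_lhs => rw [hH.spectral_theorem]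
      simp [Unitary.conjStarAlgAut_apply, mul_apply, diagonal_apply, Matrix.sum_apply, outer,
        star_apply]
      exact Finset.sum_congr rfl fun _ _ => by ring
    conv_lhs => rw [h]
    ext ⟨i, x⟩ ⟨j, y⟩
    simp only [kroneckerMap_apply, Matrix.sum_apply, Matrix.smul_apply, smul_eq_mul, Finset.sum_mul]
    exact Finset.sum_congr rfl fun _ _ => by ring

theorem isCQOn_outer_conj {ψ : Fin dA → ℂ} (hψ : star ψ ⬝ᵥ ψ = 1)
    {M : Matrix (Fin dA × Fin dB) (Fin dA × Fin dB) ℂ} (hM : M.PosSemidef) :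
    IsCQOn (outer ψ) ((outer ψ ⊗ₖ (1 : Matrix (Fin dB) (Fin dB) ℂ)) * M * (outer ψ ⊗ₖ 1)) := by
  let V : Matrix (Fin dA × Fin dB) (Fin dB) ℂ :=
    Matrix.of fun p j => ψ p.1 * (1 : Matrix (Fin dB) (Fin dB) ℂ) p.2 j
  have hV : ∀ B : Matrix (Fin dB) (Fin dB) ℂ, outer ψ ⊗ₖ B = V * B * Vᴴ := fun B => by
    ext ⟨a, i⟩ ⟨b, j⟩
    simp [V, outer, mul_apply, Matrix.one_apply, apply_ite]
    ring
  refine ⟨1, fun _ => ψ, fun _ => Vᴴ * M * V, fun _ => hM.conjTranspose_mul_mul_same V,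
    fun _ _ => by simp [outer_mulVec, hψ], fun k l => by simp [hψ, Subsingleton.elim k l], ?_⟩
  simp only [Finset.univ_unique, Finset.sum_singleton, hV, Matrix.mul_one, Matrix.mul_assoc]

theorem isCQ_of_orthonormal {κ : Type} [Fintype κ] (φ : κ → Fin dA → ℂ)
    (τ : κ → Matrix (Fin dB) (Fin dB) ℂ) (hτ : ∀ k, (τ k).PosSemidef)
    (hφ : ∀ k l, τ k ≠ 0 → τ l ≠ 0 → k ≠ l → star (φ k) ⬝ᵥ φ l = 0)
    (hφ1 : ∀ k, star (φ k) ⬝ᵥ φ k = 1)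
    {X : Matrix (Fin dA × Fin dB) (Fin dA × Fin dB) ℂ} (hX : X = ∑ k, outer (φ k) ⊗ₖ τ k)
    (htr : X.trace = 1) : IsCQ X := by
  classical
  let e := (Fintype.equivFin {k // τ k ≠ 0}).symm
  have hre : ∀ k, (((τ k).trace.re : ℝ) : ℂ) = (τ k).trace := fun k =>
    (Complex.eq_re_of_ofReal_le (hτ k).trace_nonneg).symm
  have hsum : ∀ {α : Type} [AddCommMonoid α] (f : κ → α), (∀ k, τ k = 0 → f k = 0) →
      ∑ x, f (e x) = ∑ k, f k := fun f hf => by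
    rw [Equiv.sum_comp e (fun y => f y), ← Finset.sum_subtype {k | τ k ≠ 0} (by simp) f]
    exact Finset.sum_filter_of_ne fun k _ hk h => hk (hf k h)
  have h0 : ∀ x, (τ (e x)).trace ≠ 0 := fun x h =>
    (e x).2 ((hτ _).trace_eq_zero_iff.1 h)
  refine ⟨_, fun x => φ (e x), fun x => (τ (e x)).trace.re,
    fun x => ((τ (e x)).trace)⁻¹ • τ (e x), fun x y => ?_, fun x => ?_, ?_, fun x => ⟨?_, ?_⟩, ?_⟩
  · split_ifs with h
    · rw [h, hφ1]
    · exact hφ _ _ (e x).2 (e y).2 fun h' => h (e.injective (Subtype.ext h'))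
  · exact (Complex.le_def.1 (hτ (e x)).trace_nonneg).1
  · rw [hsum (fun k => (τ k).trace.re) fun k hk => by simp [hk]]
    have : X.trace = ∑ k, (τ k).trace := by
      simp [hX, trace_sum, trace_kronecker, trace_outer, hφ1]
    rw [← Complex.re_sum, ← this, htr, Complex.one_re]
  · exact (hτ _).smul (inv_nonneg.2 (hτ _).trace_nonneg)
  · rw [trace_smul, smul_eq_mul, inv_mul_cancel₀ (h0 x)]
  · rw [hX, ← hsum (fun k => outer (φ k) ⊗ₖ τ k) fun k hk => by simp [hk]]
    refine Finset.sum_congr rfl fun x _ => ?_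
    rw [hre, kronecker_smul, smul_smul, mul_inv_cancel₀ (h0 x), one_smul]

theorem isCQ_of_isCQOn {n : ℕ} {Q : Fin n → Matrix (Fin dA) (Fin dA) ℂ}
    (hQ : ∀ i, (Q i).IsHermitian) (hQQ : ∀ i j, i ≠ j → Q i * Q j = 0)
    {X : Fin n → Matrix (Fin dA × Fin dB) (Fin dA × Fin dB) ℂ} (hX : ∀ i, IsCQOn (Q i) (X i))
    (htr : (∑ i, X i).trace = 1) : IsCQ (∑ i, X i) := by
  choose m φ τ hτ hfix horth hsum using hX
  refine isCQ_of_orthonormal (κ := Σ i, Fin (m i)) (fun x => φ x.1 x.2) (fun x => τ x.1 x.2)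
    (fun x => hτ _ _) ?_ (fun x => by simp [horth]) ?_ htr
  · rintro ⟨i, k⟩ ⟨j, l⟩ hk hl hne
    by_cases hij : i = j
    · subst hij
      have : k ≠ l := fun h => hne (by rw [h])
      simp [horth, this]
    · dsimp only at hk hl ⊢
      rw [← hfix i k hk, ← hfix j l hl, star_mulVec, (hQ i).eq, ← dotProduct_mulVec,
        mulVec_mulVec, hQQ i j hij, zero_mulVec, dotProduct_zero]
  · rw [Fintype.sum_sigma]
    exact Finset.sum_congr rfl fun i _ => hsum i

/-- The `i`-th summand of the normal form applied to `M`: the projection onto the range of `Q`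
on `A`, followed on `B` by the identity if `fixed` holds and by the point channel `R` if not. -/
def normalFormTerm (fixed : Prop) [Decidable fixed] (Q : Matrix (Fin dA) (Fin dA) ℂ)
    (R : Matrix (Fin dB) (Fin dB) ℂ) (M : Matrix (Fin dA × Fin dB) (Fin dA × Fin dB) ℂ) :
    Matrix (Fin dA × Fin dB) (Fin dA × Fin dB) ℂ :=
  if fixed then (Q ⊗ₖ (1 : Matrix (Fin dB) (Fin dB) ℂ)) * M * (Q ⊗ₖ 1)
  else ptraceB ((Q ⊗ₖ (1 : Matrix (Fin dB) (Fin dB) ℂ)) * M * (Q ⊗ₖ 1)) ⊗ₖ R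

theorem trace_normalFormTerm {fixed : Prop} [Decidable fixed] {Q : Matrix (Fin dA) (Fin dA) ℂ}
    (hQ : Q * Q = Q) {R : Matrix (Fin dB) (Fin dB) ℂ} (hR : ¬fixed → IsState R)
    (M : Matrix (Fin dA × Fin dB) (Fin dA × Fin dB) ℂ) :
    (normalFormTerm fixed Q R M).trace =
      ((Q ⊗ₖ (1 : Matrix (Fin dB) (Fin dB) ℂ)) * M).trace := by
  have h : ((Q ⊗ₖ (1 : Matrix (Fin dB) (Fin dB) ℂ)) * M * (Q ⊗ₖ 1)).trace =
      ((Q ⊗ₖ (1 : Matrix (Fin dB) (Fin dB) ℂ)) * M).trace := by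
    rw [trace_mul_comm, ← Matrix.mul_assoc, ← mul_kronecker_mul, hQ, Matrix.one_mul]
  unfold normalFormTerm
  split_ifs with hf
  · exact h
  · rw [trace_kronecker, trace_ptraceB, (hR hf).2, mul_one, h]

theorem posSemidef_blockwise_normalFormTerm {fixed : Prop} [Decidable fixed] {k : ℕ}
    {Q : Matrix (Fin dA) (Fin dA) ℂ} (hQ : Q.IsHermitian) {R : Matrix (Fin dB) (Fin dB) ℂ}
    (hR : ¬fixed → IsState R)
    {N : Matrix (Fin k × Fin dA × Fin dB) (Fin k × Fin dA × Fin dB) ℂ} (hN : N.PosSemidef) :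
    (Matrix.of fun p q : Fin k × Fin dA × Fin dB =>
      normalFormTerm fixed Q R (blockA p.1 q.1 N) p.2 q.2).PosSemidef := by
  have h := posSemidef_blockwise_conj (Q ⊗ₖ (1 : Matrix (Fin dB) (Fin dB) ℂ)) hN
  rw [(isHermitian_kronecker_one hQ).eq] at h
  unfold normalFormTerm
  split_ifs with hf
  · exact h
  · have h' := posSemidef_blockwise_ptraceB (hR hf).1 h
    simp only [blockA_of _ _ fun a b => (Q ⊗ₖ (1 : Matrix (Fin dB) (Fin dB) ℂ)) *
      blockA a b N * (Q ⊗ₖ 1)] at h'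
    exact h'

theorem isCQOn_normalFormTerm {fixed : Prop} [Decidable fixed] {Q : Matrix (Fin dA) (Fin dA) ℂ}
    (hQ : Q.IsHermitian) (hQQ : Q * Q = Q) {R : Matrix (Fin dB) (Fin dB) ℂ}
    (hR : ¬fixed → IsState R) {ψ : Fin dA → ℂ}
    (hψ : fixed → Q = outer ψ ∧ star ψ ⬝ᵥ ψ = 1)
    {M : Matrix (Fin dA × Fin dB) (Fin dA × Fin dB) ℂ} (hM : M.PosSemidef) :
    IsCQOn Q (normalFormTerm fixed Q R M) := by
  unfold normalFormTerm
  split_ifs with hf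
  · obtain ⟨rfl, h1⟩ := hψ hf
    exact isCQOn_outer_conj h1 hM
  · refine isCQOn_kronecker (posSemidef_ptraceB (posSemidef_kronecker_one_conj hQ hM)) ?_ (hR hf).1
    rw [← ptraceB_kronecker_one_mul, ← Matrix.mul_assoc, ← Matrix.mul_assoc, ← mul_kronecker_mul,
      hQQ, Matrix.one_mul]

theorem HasDANormalForm.exists_sum_normalFormTerm
    {Φ : Matrix (Fin dA × Fin dB) (Fin dA × Fin dB) ℂ →ₗ[ℂ]
      Matrix (Fin dA × Fin dB) (Fin dA × Fin dB) ℂ} (hΦ : HasDANormalForm Φ) :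
    ∃ (E : Matrix (Fin dA × Fin dB) (Fin dA × Fin dB) ℂ →ₗ[ℂ]
        Matrix (Fin dA × Fin dB) (Fin dA × Fin dB) ℂ)
      (n : ℕ) (IF : Finset (Fin n)) (ψ : Fin n → Fin dA → ℂ)
      (Q : Fin n → Matrix (Fin dA) (Fin dA) ℂ) (R : Fin n → Matrix (Fin dB) (Fin dB) ℂ),
      IsCPTP E ∧ (∀ i, (Q i).IsHermitian) ∧ (∀ i, Q i * Q i = Q i) ∧
      (∀ i j, i ≠ j → Q i * Q j = 0) ∧ ∑ i, Q i = 1 ∧ (∀ i, i ∉ IF → IsState (R i)) ∧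
      (∀ i, i ∈ IF → Q i = outer (ψ i) ∧ star (ψ i) ⬝ᵥ ψ i = 1) ∧
      ∀ ρ, Φ ρ = ∑ i, normalFormTerm (i ∈ IF) (Q i) (R i) (E ρ) := by
  obtain ⟨E, n, IB, IF, IP, ψ, P, R, hE, hBF, hBP, hFP, hU, hψ, hP, hPP, hPψ, h1, hR, hΦ⟩ := hΦ
  have hBFP : Disjoint (IB ∪ IF) IP := Finset.disjoint_union_left.2 ⟨hBP, hFP⟩
  have hcase : ∀ i, i ∉ IP → i ∈ IB ∪ IF := fun i hi => by
    have := Finset.mem_univ i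
    rw [← hU, Finset.mem_union] at this
    exact this.resolve_right hi
  let Q : Fin n → Matrix (Fin dA) (Fin dA) ℂ := fun i => if i ∈ IP then P i else outer (ψ i)
  have hQP : ∀ i ∈ IP, Q i = P i := fun i hi => if_pos hi
  have hQψ : ∀ i ∈ IB ∪ IF, Q i = outer (ψ i) := fun i hi =>
    if_neg (Finset.disjoint_left.1 hBFP hi)
  refine ⟨E, n, IF, ψ, Q, R, hE, fun i => ?_, fun i => ?_, fun i j hij => ?_, ?_, fun i hi => ?_,
    fun i hi => ?_, fun ρ => ?_⟩
  · by_cases hi : i ∈ IP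
    · rw [hQP i hi]
      exact (hP i hi).1
    · rw [hQψ i (hcase i hi)]
      exact outer_isHermitian _
  · by_cases hi : i ∈ IP
    · rw [hQP i hi]
      exact (hP i hi).2.1
    · rw [hQψ i (hcase i hi), outer_mul_outer, hψ i (hcase i hi) i (hcase i hi), if_pos rfl,
        one_smul, outer]
  · by_cases hi : i ∈ IP <;> by_cases hj : j ∈ IP
    · rw [hQP i hi, hQP j hj, hPP i hi j hj hij]
    · rw [hQP i hi, hQψ j (hcase j hj), hPψ i hi j (hcase j hj)]
    · rw [hQψ i (hcase i hi), hQP j hj, ← conjTranspose_eq_zero, conjTranspose_mul,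
        (hP j hj).1.eq, (outer_isHermitian _).eq, hPψ j hj i (hcase i hi)]
    · rw [hQψ i (hcase i hi), hQψ j (hcase j hj), outer_mul_outer,
        hψ i (hcase i hi) j (hcase j hj), if_neg hij, zero_smul]
  · rw [← hU, Finset.sum_union hBFP, Finset.sum_congr rfl hQψ, Finset.sum_congr rfl hQP, h1]
  · refine hR i ?_
    have := Finset.mem_univ i
    rw [← hU] at this
    simp only [Finset.mem_union] at this ⊢
    tauto
  · have hi' : i ∈ IB ∪ IF := Finset.mem_union_right _ hi
    exact ⟨hQψ i hi', by rw [hψ i hi' i hi', if_pos rfl]⟩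
  · rw [hΦ, ← hU, Finset.sum_union hBFP, Finset.sum_union hBF]
    congr 1
    · congr 1
      · refine Finset.sum_congr rfl fun i hi => ?_
        rw [normalFormTerm, if_neg (Finset.disjoint_left.1 hBF hi),
          hQψ i (Finset.mem_union_left _ hi)]
      · refine Finset.sum_congr rfl fun i hi => ?_
        rw [normalFormTerm, if_pos hi, hQψ i (Finset.mem_union_right _ hi)]
    · refine Finset.sum_congr rfl fun i hi => ?_
      rw [normalFormTerm, if_neg (Finset.disjoint_right.1 hFP hi), hQP i hi]

end Auxiliary

/-- converse direction of Theorem 2: any map with the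
discord-annihilating normal form is CPTP and discord-annihilating. -/
theorem stmt_10 (dA dB : ℕ)
    (Φ : Matrix (Fin dA × Fin dB) (Fin dA × Fin dB) ℂ →ₗ[ℂ]
      Matrix (Fin dA × Fin dB) (Fin dA × Fin dB) ℂ)
    (hΦ : HasDANormalForm Φ) :
    IsCPTP Φ ∧
    ∀ ρ : Matrix (Fin dA × Fin dB) (Fin dA × Fin dB) ℂ, IsState ρ → IsCQ (Φ ρ) := by
  obtain ⟨E, n, IF, ψ, Q, R, hE, hQ, hQQ, hQ0, hQ1, hR, hψ, hΦ⟩ := hΦ.exists_sum_normalFormTerm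
  have htr : ∀ X, (Φ X).trace = X.trace := fun X => by
    rw [hΦ, trace_sum]
    simp_rw [fun i => trace_normalFormTerm (hQQ i) (hR i) (E X)]
    have hsum : ∑ i, Q i ⊗ₖ (1 : Matrix (Fin dB) (Fin dB) ℂ) = 1 := by
      rw [← one_kronecker_one, ← hQ1]
      ext ⟨a, i⟩ ⟨b, j⟩
      simp [Matrix.sum_apply, Finset.sum_mul]
    rw [← trace_sum, ← Finset.sum_mul, hsum, Matrix.one_mul, hE.1]
  refine ⟨⟨htr, fun k M hM => ?_⟩, fun ρ hρ => ?_⟩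
  · have h : idTensor k Φ M = ∑ i, Matrix.of fun p q : Fin k × Fin dA × Fin dB =>
        normalFormTerm (i ∈ IF) (Q i) (R i) (blockA p.1 q.1 (idTensor k E M)) p.2 q.2 := by
      ext p q
      simp only [blockA_idTensor, Matrix.sum_apply, of_apply]
      rw [← Matrix.sum_apply, ← hΦ]
      rfl
    rw [h]
    exact posSemidef_sum _ fun i _ =>
      posSemidef_blockwise_normalFormTerm (hQ i) (hR i) (hE.2 k M hM)
  · have h := htr ρ
    rw [hρ.2] at h
    rw [hΦ] at h ⊢
    exact isCQ_of_isCQOn hQ hQ0 (fun i => isCQOn_normalFormTerm (hQ i) (hQQ i) (hR i) (hψ i)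
      (hE.isState_map hρ).1) h
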